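/- arXiv:1907.08529 — 2 statements merged into one kernel-verified Lean document; each statement's English description precedes it below -/
import Mathlib

section
/- Let M ⊆ C(Ω, [0,1]) be closed under the operation (φ, f, g) ↦ φf + (1-φ)g for φ, f, g ∈ M. Suppose m₁, m₂, m₃ ∈ M with m₁(t) = 0, m₂(t) = 1, and 0 < m₃(t) < 1 for some t ∈ Ω. Then the closure of M(t) = {m(t) : m ∈ M} in [0,1] is all of [0,1]. -/
/-- A closed set of reals stable under the convex combination with one fixed weight `a ∈ (0, 1)`
has no gaps. -/
theorem IsClosed.Icc_subset_of_combination_mem {K : Set ℝ} (hK : IsClosed K) {a : ℝ}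
    (ha : a ∈ Set.Ioo (0 : ℝ) 1) (hcomb : ∀ u ∈ K, ∀ v ∈ K, a * u + (1 - a) * v ∈ K)
    {b c : ℝ} (hb : b ∈ K) (hc : c ∈ K) : Set.Icc b c ⊆ K := by
  rintro x ⟨hbx, hxc⟩
  by_contra hx
  obtain ⟨u, ⟨huK, hu⟩, hmax⟩ := (isCompact_Icc.inter_left hK).exists_isGreatest
    (⟨b, hb, le_rfl, hbx⟩ : (K ∩ Set.Icc b x).Nonempty)
  obtain ⟨v, ⟨hvK, hv⟩, hmin⟩ := (isCompact_Icc.inter_left hK).exists_isLeast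
    (⟨c, hc, hxc, le_rfl⟩ : (K ∩ Set.Icc x c).Nonempty)
  have hux : u < x := lt_of_le_of_ne hu.2 fun h => hx (h ▸ huK)
  have hxv : x < v := lt_of_le_of_ne hv.1 fun h => hx (h ▸ hvK)
  have hw := hcomb u huK v hvK
  have huw : u < a * u + (1 - a) * v := by nlinarith [ha.2]
  have hwv : a * u + (1 - a) * v < v := by nlinarith [ha.1]
  rcases le_total (a * u + (1 - a) * v) x with h | h
  · exact huw.not_ge (hmax ⟨hw, hu.1.trans huw.le, h⟩)
  · exact hwv.not_ge (hmin ⟨hw, h, hwv.le.trans hv.2⟩)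


/-- If `M ⊆ C(Ω,[0,1])` is a multiplier of itself and contains functions taking at `t`
the values `0`, `1` and some value strictly between, then `{m(t) : m ∈ M}` is dense
in `[0,1]`. -/
theorem closure_values_eq_Icc {Ω : Type*} [TopologicalSpace Ω]
    (M : Set C(Ω, ℝ)) (hM01 : ∀ m ∈ M, ∀ x, m x ∈ Set.Icc (0 : ℝ) 1)
    (hmult : ∀ φ ∈ M, ∀ f ∈ M, ∀ g ∈ M, φ * f + (1 - φ) * g ∈ M)
    (t : Ω) (m₁ m₂ m₃ : C(Ω, ℝ)) (h₁ : m₁ ∈ M) (h₂ : m₂ ∈ M) (h₃ : m₃ ∈ M)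
    (hv₁ : m₁ t = 0) (hv₂ : m₂ t = 1) (hv₃ : m₃ t ∈ Set.Ioo (0 : ℝ) 1) :
    closure {r : ℝ | ∃ m ∈ M, m t = r} = Set.Icc (0 : ℝ) 1 := by
  refine (closure_minimal ?_ isClosed_Icc).antisymm
    (isClosed_closure.Icc_subset_of_combination_mem hv₃ (fun u hu v hv => ?_)
      (subset_closure ⟨m₁, h₁, hv₁⟩) (subset_closure ⟨m₂, h₂, hv₂⟩))
  · rintro _ ⟨m, hm, rfl⟩
    exact hM01 m hm t
  · refine map_mem_closure₂ (f := fun u v => m₃ t * u + (1 - m₃ t) * v) (by fun_prop) hu hv ?_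
    rintro _ ⟨f, hf, rfl⟩ _ ⟨g, hg, rfl⟩
    exact ⟨_, hmult m₃ h₃ f hf g hg, by simp⟩
end

section
/- For every a ∈ (0,1), the set {(1 - cⁿ)ᵏ : n, k ∈ ℕ₊} is dense in [0,1] for any fixed c ∈ (0,1); i.e., for every ε > 0 and every b ∈ (0,1) there exist n, k ∈ ℕ₊ with |b - (1 - cⁿ)ᵏ| < ε. -/
/-- For fixed `c ∈ (0,1)`, the numbers `(1 - cⁿ)ᵏ` (`n, k ≥ 1`) are dense in `[0,1]`. -/
theorem dense_one_sub_pow_pow (c : ℝ) (hc : c ∈ Set.Ioo (0 : ℝ) 1)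
    (b : ℝ) (hb : b ∈ Set.Ioo (0 : ℝ) 1) (ε : ℝ) (hε : 0 < ε) :
    ∃ n k : ℕ, 0 < n ∧ 0 < k ∧ |b - (1 - c ^ n) ^ k| < ε := by
  obtain ⟨n, hn⟩ := exists_pow_lt_of_lt_one (lt_min hε one_pos) hc.2
  obtain ⟨hnε, hn1⟩ := lt_min_iff.mp hn
  have hpos : 0 < c ^ n := pow_pos hc.1 n
  have hn0 : 0 < n := Nat.pos_of_ne_zero (by rintro rfl; simp at hn1)
  obtain ⟨k, hlt, hle⟩ := exists_nat_pow_near_of_lt_one hb.1 hb.2.le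
    (sub_pos.mpr hn1) (sub_lt_self 1 hpos)
  refine ⟨n, k + 1, hn0, k.succ_pos, ?_⟩
  have hk : (1 - c ^ n) ^ k ≤ 1 := pow_le_one₀ (by linarith) (by linarith)
  rw [abs_of_pos (sub_pos.mpr hlt)]
  calc b - (1 - c ^ n) ^ (k + 1) ≤ (1 - c ^ n) ^ k - (1 - c ^ n) ^ (k + 1) := by gcongr
    _ = (1 - c ^ n) ^ k * c ^ n := by ring
    _ ≤ c ^ n := mul_le_of_le_one_left hpos.le hk
    _ < ε := hnε
end
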